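/- Let n ≥ 3. The dimension of the symmetric traveling salesman polytope T_n = conv(X), i.e. the dimension of the affine span of X in ℝ^{n(n-1)/2}, equals n(n-3)/2. -/

import Mathlib

open Finset
noncomputable section
open scoped Classical

/-- Index type for the coordinates of `ℝ^{n(n-1)/2}`: unordered pairs of distinct
vertices of the complete graph `K_n` on `Fin n`. -/
abbrev EdgeIdx (n : ℕ) := {e : Sym2 (Fin n) // ¬ e.IsDiag}

/-- The incidence vector of the Hamiltonian cycle of `K_n` determined by a
permutation `σ` of the vertices (the cycle visiting `σ 0, σ 1, …, σ (n-1)` in order). -/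
def cycleVec (n : ℕ) (σ : Equiv.Perm (Fin n)) : EdgeIdx n → ℝ :=
  fun e => if ∃ i : Fin n, (e : Sym2 (Fin n)) = s(σ i, σ (finRotate n i)) then 1 else 0

/-- `X`, the (finite) set of incidence vectors of Hamiltonian cycles of `K_n`. -/
def hamX (n : ℕ) : Finset (EdgeIdx n → ℝ) := Finset.image (cycleVec n) Finset.univ

/-- The incidence vector of an edge of `K_n`, as a function of its endpoints
(zero when they coincide). -/
def edgeVec (n : ℕ) (i j : Fin n) : EdgeIdx n → ℝ :=
  fun e => if (e : Sym2 (Fin n)) = s(i, j) then 1 else 0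

lemma edgeVec_comm (n : ℕ) (i j : Fin n) : edgeVec n i j = edgeVec n j i := by
  unfold edgeVec
  rw [Sym2.eq_swap]

/-- Consecutive pairs of a cyclic order on at least three points are distinct. -/
lemma injective_cyclePair {n : ℕ} (hn : 3 ≤ n) (σ : Equiv.Perm (Fin n)) :
    Function.Injective fun i => s(σ i, σ (finRotate n i)) := by
  obtain ⟨m, rfl⟩ := Nat.exists_eq_add_of_le' hn
  intro i j h
  simp only [Sym2.eq_iff, EmbeddingLike.apply_eq_iff_eq] at h
  rcases h with h | ⟨h₁, h₂⟩
  · exact h.1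
  · exfalso
    rw [finRotate_apply] at h₁ h₂
    rw [h₁, add_assoc] at h₂
    have h₃ : (1 + 1 : Fin (m + 3)) = 0 := by simpa using h₂
    have := congrArg Fin.val h₃
    simp [Fin.val_add, Nat.mod_eq_of_lt (show 2 < m + 3 by omega)] at this

lemma cycleVec_eq_sum {n : ℕ} (hn : 3 ≤ n) (σ : Equiv.Perm (Fin n)) :
    cycleVec n σ = ∑ i, edgeVec n (σ i) (σ (finRotate n i)) := by
  ext e
  simp only [cycleVec, edgeVec, Finset.sum_apply]
  split_ifs with h
  · obtain ⟨i, hi⟩ := h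
    rw [Finset.sum_eq_single i]
    · simp [hi]
    · intro j _ hj
      rw [if_neg]
      intro h
      exact hj (injective_cyclePair hn σ (h.symm.trans hi))
    · simp
  · exact (Finset.sum_eq_zero fun i _ => if_neg fun hi => h ⟨i, hi⟩).symm

/-- The vector of vertex degrees of an edge weighting of `K_n`. -/
def degreeMap (n : ℕ) : (EdgeIdx n → ℝ) →ₗ[ℝ] (Fin n → ℝ) where
  toFun x v := ∑ e : EdgeIdx n, if v ∈ (e : Sym2 (Fin n)) then x e else 0
  map_add' x y := by
    ext v
    simp [← Finset.sum_add_distrib, ← ite_add_zero]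
  map_smul' r x := by
    ext v
    simp [Finset.mul_sum]

lemma degreeMap_edgeVec {n : ℕ} {i j : Fin n} (h : i ≠ j) :
    degreeMap n (edgeVec n i j) = Pi.single i 1 + Pi.single j 1 := by
  ext v
  have hd : ¬ s(i, j).IsDiag := by simpa using h
  simp only [degreeMap, edgeVec, LinearMap.coe_mk, AddHom.coe_mk]
  rw [Finset.sum_eq_single (⟨s(i, j), hd⟩ : EdgeIdx n)]
  · simp only [Sym2.mem_iff, if_true, Pi.add_apply, Pi.single_apply]
    grind
  · intro e _ he
    rw [if_neg fun h' => he (Subtype.ext h'), ite_self]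
  · simp

lemma degreeMap_cycleVec {n : ℕ} (hn : 3 ≤ n) (σ : Equiv.Perm (Fin n)) :
    degreeMap n (cycleVec n σ) = 2 := by
  have hne (i : Fin n) : σ i ≠ σ (finRotate n i) := by
    obtain ⟨m, rfl⟩ := Nat.exists_eq_add_of_le' hn
    simp
  have hsum (τ : Equiv.Perm (Fin n)) :
      ∑ i, (Pi.single (τ i) 1 : Fin n → ℝ) = 1 := by
    rw [Equiv.sum_comp τ fun i => (Pi.single i 1 : Fin n → ℝ)]
    exact Finset.univ_sum_single (1 : Fin n → ℝ)
  rw [cycleVec_eq_sum hn, map_sum]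
  simp_rw [degreeMap_edgeVec (hne _), Finset.sum_add_distrib]
  rw [hsum σ, ← one_add_one_eq_two]
  congr 1
  exact hsum ((finRotate n).trans σ)

lemma degreeMap_surjective {n : ℕ} (hn : 3 ≤ n) : Function.Surjective (degreeMap n) := by
  rw [← LinearMap.range_eq_top, eq_top_iff, ← (Pi.basisFun ℝ (Fin n)).span_eq,
    Submodule.span_le]
  rintro _ ⟨v, rfl⟩
  obtain ⟨u, hu⟩ := Finset.exists_mem_notMem_of_card_lt_card
    (s := {v}) (t := (Finset.univ : Finset (Fin n))) (by simp; omega)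
  obtain ⟨w, hw⟩ := Finset.exists_mem_notMem_of_card_lt_card
    (s := {v, u}) (t := (Finset.univ : Finset (Fin n)))
    (Finset.card_le_two.trans_lt (by simp; omega))
  simp only [Finset.mem_univ, Finset.mem_singleton, Finset.mem_insert, true_and, not_or] at hu hw
  refine ⟨(2 : ℝ)⁻¹ • (edgeVec n v u + edgeVec n v w - edgeVec n u w), ?_⟩
  rw [map_smul, map_sub, map_add, degreeMap_edgeVec (Ne.symm hu),
    degreeMap_edgeVec (Ne.symm hw.1), degreeMap_edgeVec (Ne.symm hw.2), Pi.basisFun_apply]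
  ext i
  simp only [Pi.smul_apply, Pi.add_apply, Pi.sub_apply, smul_eq_mul]
  ring

/-- Exchanging the two middle vertices of a path of four consecutive vertices of a tour. -/
lemma exchange_of_sum_cycle_const {n : ℕ} (c : Fin n → Fin n → ℝ) (hc : ∀ i j, c i j = c j i)
    (h : ∀ σ τ : Equiv.Perm (Fin n),
      ∑ i, c (σ i) (σ (finRotate n i)) = ∑ i, c (τ i) (τ (finRotate n i)))
    {i j k l : Fin n} (hd : [i, j, k, l].Nodup) : c i j + c k l = c i k + c j l := by
  have hn : 4 ≤ n := by simpa using hd.length_le_card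
  obtain ⟨m, rfl⟩ := Nat.exists_eq_add_of_le' hn
  have hinj : Function.Injective ![i, j, k, l] := by
    intro a b hab
    fin_cases a <;> fin_cases b <;> simp_all
  obtain ⟨σ, hσ⟩ := (Equiv.Perm.isMultiplyPretransitive (Fin (m + 4)) 4).exists_smul_eq
    (Fin.castLEEmb (by omega)) ⟨_, hinj⟩
  have h0 : σ 0 = i := DFunLike.congr_fun hσ 0
  have h1 : σ 1 = j := DFunLike.congr_fun hσ 1
  have h2 : σ 2 = k := DFunLike.congr_fun hσ 2
  have h3 : σ 3 = l := DFunLike.congr_fun hσ 3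
  have v2 : 2 % (m + 4) = 2 := Nat.mod_eq_of_lt (by omega)
  have v3 : 3 % (m + 4) = 3 := Nat.mod_eq_of_lt (by omega)
  have hs2 : (1 + 1 : Fin (m + 4)) = 2 := rfl
  have hs3 : (2 + 1 : Fin (m + 4)) = 3 := by
    simp [Fin.ext_iff, Fin.val_add]
  have s0 : Equiv.swap (1 : Fin (m + 4)) 2 0 = 0 :=
    Equiv.swap_apply_of_ne_of_ne (by simp) (by simp [Fin.ext_iff, v2])
  have s3 : Equiv.swap (1 : Fin (m + 4)) 2 3 = 3 :=
    Equiv.swap_apply_of_ne_of_ne (by simp [Fin.ext_iff, v3]) (by simp [Fin.ext_iff, v2, v3])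
  have hfix (a : Fin (m + 4)) (h0 : a ≠ 0) (h1 : a ≠ 1) (h2 : a ≠ 2) :
      Equiv.swap (1 : Fin (m + 4)) 2 a = a ∧
        Equiv.swap (1 : Fin (m + 4)) 2 (a + 1) = a + 1 := by
    refine ⟨Equiv.swap_apply_of_ne_of_ne h1 h2, Equiv.swap_apply_of_ne_of_ne ?_ ?_⟩
    · simpa using h0
    · rw [← hs2]
      simpa using h1
  have key := h σ (σ * Equiv.swap 1 2)
  rw [← sub_eq_zero, ← Finset.sum_sub_distrib,
    ← Finset.sum_subset (Finset.subset_univ ({0, 1, 2} : Finset (Fin (m + 4))))] at key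
  · rw [Finset.sum_insert (by simp [Fin.ext_iff, v2]),
      Finset.sum_insert (by simp [Fin.ext_iff, v2]), Finset.sum_singleton] at key
    simp only [finRotate_apply, zero_add, hs2, hs3, Equiv.Perm.mul_apply, s0, s3,
      Equiv.swap_apply_left, Equiv.swap_apply_right, h0, h1, h2, h3] at key
    linarith [hc j k]
  · intro a _ ha
    simp only [Finset.mem_insert, Finset.mem_singleton, not_or] at ha
    obtain ⟨ha₁, ha₂⟩ := hfix a ha.1 ha.2.1 ha.2.2
    simp [finRotate_apply, ha₁, ha₂]

lemma exists_potential_of_exchange {n : ℕ} (hn : 3 ≤ n) (c : Fin n → Fin n → ℝ)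
    (hc : ∀ i j, c i j = c j i)
    (h : ∀ i j k l, [i, j, k, l].Nodup → c i j + c k l = c i k + c j l) :
    ∃ a : Fin n → ℝ, ∀ i j, i ≠ j → c i j = a i + a j := by
  obtain ⟨m, rfl⟩ := Nat.exists_eq_add_of_le' hn
  have h01 : (0 : Fin (m + 3)) ≠ 1 := by simp
  have h02 : (0 : Fin (m + 3)) ≠ 2 := by
    simp [Fin.ext_iff, Nat.mod_eq_of_lt (show 2 < m + 3 by omega)]
  have h12 : (1 : Fin (m + 3)) ≠ 2 := by
    simp [Fin.ext_iff, Nat.mod_eq_of_lt (show 2 < m + 3 by omega)]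
  generalize (0 : Fin (m + 3)) = o at *
  generalize (1 : Fin (m + 3)) = p at *
  generalize (2 : Fin (m + 3)) = q at *
  have hp (j) (hj : j ≠ o) (hjp : j ≠ p) : c p j + c o p + c o q - c p q = c o p + c o j := by
    by_cases hjq : j = q
    · subst hjq; ring
    · have := h p j q o (by simp; grind)
      linarith [hc q o, hc j o]
  have hij (i j) (hi : i ≠ o) (hj : j ≠ o) (hne : i ≠ j) :
      c i j + c o p + c o q - c p q = c o i + c o j := by
    by_cases hip : i = p
    · subst hip; exact hp j hj hne.symm
    by_cases hjp : j = p
    · subst hjp; linarith [hp i hi hip, hc i j]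
    · have := h i j p o (by simp; grind)
      linarith [hp i hi hip, hc i p, hc p o, hc j o]
  refine ⟨fun i => if i = o then (c o p + c o q - c p q) / 2
    else c o i - (c o p + c o q - c p q) / 2, fun i j hne => ?_⟩
  by_cases hi : i = o
  · subst hi
    simp [hne.symm]
  by_cases hj : j = o
  · subst hj
    simp [hne, hc i j]
  · simp only [if_neg hi, if_neg hj]
    linarith [hij i j hi hj hne]

lemma eq_sum_degreeMap {n : ℕ} (φ : (EdgeIdx n → ℝ) →ₗ[ℝ] ℝ) (a : Fin n → ℝ)
    (ha : ∀ i j, i ≠ j → φ (edgeVec n i j) = a i + a j) (x : EdgeIdx n → ℝ) :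
    φ x = ∑ v, a v * degreeMap n x v := by
  let ψ : (EdgeIdx n → ℝ) →ₗ[ℝ] ℝ := ∑ v, a v • (LinearMap.proj v ∘ₗ degreeMap n)
  suffices φ = ψ by simp [this, ψ]
  refine (Pi.basisFun ℝ (EdgeIdx n)).ext fun e => ?_
  obtain ⟨e, he⟩ := e
  induction e using Sym2.ind with
  | _ i j =>
  have hne : i ≠ j := by simpa using he
  have hs : (Pi.basisFun ℝ (EdgeIdx n)) ⟨s(i, j), he⟩ = edgeVec n i j := by
    ext f
    simp [edgeVec, Pi.single_apply, Subtype.ext_iff]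
  rw [hs, ha i j hne]
  simp [ψ, degreeMap_edgeVec hne, mul_add, Finset.sum_add_distrib, Pi.single_apply]

lemma direction_affineSpan_hamX {n : ℕ} (hn : 3 ≤ n) :
    (affineSpan ℝ (hamX n : Set (EdgeIdx n → ℝ))).direction = LinearMap.ker (degreeMap n) := by
  rw [direction_affineSpan]
  have hmem (σ : Equiv.Perm (Fin n)) : cycleVec n σ ∈ (hamX n : Set (EdgeIdx n → ℝ)) := by
    simp [hamX]
  apply le_antisymm
  · rw [vectorSpan, Submodule.span_le]
    rintro _ ⟨x, hx, y, hy, rfl⟩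
    simp only [hamX, Finset.coe_image, Finset.coe_univ, Set.image_univ, Set.mem_range] at hx hy
    obtain ⟨σ, rfl⟩ := hx
    obtain ⟨τ, rfl⟩ := hy
    simp [degreeMap_cycleVec hn]
  · intro x hx
    by_contra hxV
    obtain ⟨φ, hφx, hφ⟩ := Submodule.exists_le_ker_of_notMem hxV
    apply hφx
    have hconst (σ τ : Equiv.Perm (Fin n)) : φ (cycleVec n σ) = φ (cycleVec n τ) := by
      rw [← sub_eq_zero, ← map_sub]
      exact hφ (vsub_mem_vectorSpan ℝ (hmem σ) (hmem τ))
    simp_rw [cycleVec_eq_sum hn, map_sum] at hconst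
    have hc (i j) : φ (edgeVec n i j) = φ (edgeVec n j i) := by rw [edgeVec_comm]
    obtain ⟨a, ha⟩ := exists_potential_of_exchange hn (fun i j => φ (edgeVec n i j)) hc
      fun i j k l hd => exchange_of_sum_cycle_const _ hc hconst hd
    rw [eq_sum_degreeMap φ a ha, LinearMap.mem_ker.1 hx]
    simp

/-- **dimension of the STSP.**  For `n ≥ 3`, the dimension of the
symmetric traveling salesman polytope `T_n = conv(X)`, i.e. the dimension of the
affine span of `X` in `ℝ^{n(n-1)/2}` (the rank of its direction submodule),
equals `n(n-3)/2`. -/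
theorem dimension_of_tsp_polytope (n : ℕ) (hn : 3 ≤ n) :
    Module.finrank ℝ
        (affineSpan ℝ (hamX n : Set (EdgeIdx n → ℝ))).direction
      = n * (n - 3) / 2 := by
  rw [direction_affineSpan_hamX hn]
  have hrank := LinearMap.finrank_range_add_finrank_ker (degreeMap n)
  rw [LinearMap.range_eq_top.2 (degreeMap_surjective hn), finrank_top, Module.finrank_fin_fun,
    Module.finrank_fintype_fun_eq_card, Sym2.card_subtype_not_diag, Fintype.card_fin,
    Nat.choose_two_right] at hrank
  obtain ⟨m, rfl⟩ := Nat.exists_eq_add_of_le' hn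
  have hsplit : (m + 3) * (m + 3 - 1) = (m + 3) * (m + 3 - 3) + 2 * (m + 3) := by
    simp only [Nat.add_sub_cancel, show m + 3 - 1 = m + 2 by omega]
    ring
  omega
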